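/- arXiv:0908.2556 — 5 statements merged into one kernel-verified Lean document; each statement's English description precedes it below -/
import Mathlib

section
/- For any 0 ≤ p < n, the following two measures on E_p × ⋯ × E_n coincide: γ_p(dx_p) ∏_{p≤q<n} Q_{q+1}(x_q, dx_{q+1}) = γ_n(dx_n) ∏_{p≤q<n} M_{q+1,η_q}(x_{q+1}, dx_q). (First assertion of Lemma 4.1, the backward decomposition of the unnormalized Feynman-Kac path measure.) -/
open MeasureTheory ProbabilityTheory ENNReal

noncomputable section

variable {E : ℕ → Type*} [∀ n, MeasurableSpace (E n)]

/-- Normalization `μ / μ(1)` of a measure. -/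
def nz {α : Type*} [MeasurableSpace α] (μ : Measure α) : Measure α := (μ Set.univ)⁻¹ • μ

variable (M : ∀ n, Kernel (E n) (E (n+1))) (G : ∀ n, E n → ℝ) (H : ∀ n, E n → E (n+1) → ℝ)

/-- The Feynman-Kac kernel `Q_{q+1}(x,dy) = G_q(x) M_{q+1}(x,dy)`. -/
def Qk (q : ℕ) (x : E q) : Measure (E (q+1)) := ENNReal.ofReal (G q x) • (M q x : Measure (E (q+1)))

/-- The backward kernel `M_{q+1,η}(y,dx) = G_q(x) H_{q+1}(x,y) η(dx) / η(G_q H_{q+1}(·,y))`. -/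
def Mback (q : ℕ) (η : Measure (E q)) (y : E (q+1)) : Measure (E q) :=
  (∫⁻ x, ENNReal.ofReal (G q x * H q x y) ∂η)⁻¹ •
    η.withDensity fun x => ENNReal.ofReal (G q x * H q x y)

/-- The unnormalized Feynman-Kac marginal `γ_n = η₀ Q_{0,n}`. -/
def gamma (η0 : Measure (E 0)) : ∀ n, Measure (E n)
  | 0 => η0
  | n + 1 => (gamma η0 n).bind (Qk M G n)

/-- The Boltzmann-Gibbs transform `Ψ_{G_q}(η)(dx) = G_q(x) η(dx) / η(G_q)`. -/
def PsiG (q : ℕ) (η : Measure (E q)) : Measure (E q) :=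
  (∫⁻ x, ENNReal.ofReal (G q x) ∂η)⁻¹ • η.withDensity fun x => ENNReal.ofReal (G q x)

/-- `Φ_{q+1}(η) = Ψ_{G_q}(η) M_{q+1}`. -/
def Phi (q : ℕ) (η : Measure (E q)) : Measure (E (q+1)) :=
  (PsiG G q η).bind fun x => (M q x : Measure (E (q+1)))

/-- `η Q_{p,q}` as a measure on `E q` (junk `0` for `q < p`). -/
def QQabs (p : ℕ) (η : Measure (E p)) : ∀ q, Measure (E q)
  | 0 => if h : p = 0 then cast (congrArg (fun m => Measure (E m)) h) η else 0
  | q + 1 =>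
      if h : p = q + 1 then cast (congrArg (fun m => Measure (E m)) h) η
      else (QQabs p η q).bind (Qk M G q)

/-- Forward segment integral: `x_p ↦ ∫ ∏_{p ≤ q < p+k} Q_{q+1}(x_q, dx_{q+1}) F(x_p,…,x_{p+k})`. -/
def fwdSeg (p : ℕ) : (k : ℕ) → E p → ((∀ i : Fin (k+1), E (p + ↑i)) → ℝ) → ℝ
  | 0, x, F => F (Fin.cons x fun j => j.elim0)
  | k + 1, x, F =>
      fwdSeg p k x fun xs => ∫ y, F (Fin.snoc xs y) ∂ (Qk M G (p + k) (xs (Fin.last k)))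

/-- Backward segment integral from `x_{p+k}`:
`x_{p+k} ↦ ∫ ∏_{p ≤ q < p+k} M_{q+1,θ_q}(x_{q+1}, dx_q) F(x_p,…,x_{p+k})`. -/
def bwdSeg (θ : ∀ q, Measure (E q)) (p : ℕ) :
    (k : ℕ) → E (p + k) → ((∀ i : Fin (k+1), E (p + ↑i)) → ℝ) → ℝ
  | 0, x, F => F (Fin.cons x fun j => j.elim0)
  | k + 1, x, F =>
      ∫ y, bwdSeg θ p k y (fun xs => F (Fin.snoc xs x)) ∂ (Mback G H (p + k) (θ (p + k)) x)

/-- Backward integral from level `p` down to level `0`: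
`x_p ↦ ∫ ∏_{q=1}^{p} M_{q,θ_{q-1}}(x_q, dx_{q-1}) F(x_0,…,x_p)`. -/
def bwd0 (θ : ∀ q, Measure (E q)) : (p : ℕ) → E p → ((∀ i : Fin (p+1), E ↑i) → ℝ) → ℝ
  | 0, x, F => F (Fin.cons x fun j => j.elim0)
  | p + 1, x, F => ∫ y, bwd0 θ p y (fun xs => F (Fin.snoc xs x)) ∂ (Mback G H p (θ p) x)

/-- Integrate out the coordinates `p+1,…,n` of `F` forward through the `Q` chain. -/
def fwdAbs (p : ℕ) : (n : ℕ) → ((∀ i : Fin (n+1), E ↑i) → ℝ) → (∀ i : Fin (p+1), E ↑i) → ℝ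
  | 0, F => fun xs => F fun i => xs (Fin.castLE (by omega) i)
  | n + 1, F =>
      if h : n + 1 ≤ p then fun xs => F fun i => xs (Fin.castLE (by omega) i)
      else fwdAbs p n fun xs => ∫ y, F (Fin.snoc xs y) ∂ (Qk M G n (xs (Fin.last n)))

/-- The operator `D_{p,n}` associated to the family of backward measures `θ`. -/
def Dop (θ : ∀ q, Measure (E q)) (p n : ℕ) (F : (∀ i : Fin (n+1), E ↑i) → ℝ) (x : E p) : ℝ :=
  bwd0 G H θ p x (fwdAbs M G p n F)

/-- `Γ_n(F)`, the unnormalized Feynman-Kac path integral. -/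
def GammaInt (η0 : Measure (E 0)) : (n : ℕ) → ((∀ i : Fin (n+1), E ↑i) → ℝ) → ℝ
  | 0, F => ∫ x, F (Fin.cons x fun j => j.elim0) ∂ η0
  | n + 1, F => GammaInt η0 n fun xs => ∫ y, F (Fin.snoc xs y) ∂ (Qk M G n (xs (Fin.last n)))

/-- `Q_{p,n}(f)` acting on functions (junk `0` if `n < p`). -/
def Qfun (p : ℕ) : (n : ℕ) → (E n → ℝ) → E p → ℝ
  | 0, f => if h : p = 0 then fun x => f (cast (congrArg E h) x) else 0
  | n + 1, f =>
      if h : p = n + 1 then fun x => f (cast (congrArg E h) x)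
      else Qfun p n fun x => ∫ y, f y ∂ (Qk M G n x)

/-- The composition `M_{n,θ_{n-1}} M_{n-1,θ_{n-2}} ⋯ M_{p+1,θ_p}` acting on functions on `E p`
(identity when `n = p`, junk `0` if `n < p`). -/
def Mchain (θ : ∀ q, Measure (E q)) (p : ℕ) : (n : ℕ) → (E p → ℝ) → E n → ℝ
  | 0, f => if h : p = 0 then fun x => f (cast (congrArg E h.symm) x) else 0
  | n + 1, f =>
      if h : p = n + 1 then fun x => f (cast (congrArg E h.symm) x)
      else fun x => ∫ y, Mchain θ p n f y ∂ (Mback G H n (θ n) x)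

/-- The forward recursion `F_0 = f_0`, `F_{p+1} = f_{p+1} + M_{p+1,θ_p}(F_p)`. -/
def Frec (θ : ∀ q, Measure (E q)) (f : ∀ q, E q → ℝ) : ∀ p, E p → ℝ
  | 0 => f 0
  | p + 1 => fun x => f (p+1) x + ∫ y, Frec θ f p y ∂ (Mback G H p (θ p) x)

/-- Glue a path `(x_0,…,x_p)` with a segment `(x_p,…,x_{p+k})`. -/
def glue (p k : ℕ) (xs : ∀ i : Fin (p+1), E ↑i) (ys : ∀ i : Fin (k+1), E (p + ↑i)) :
    ∀ i : Fin (p+k+1), E ↑i := fun i =>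
  if h : (i : ℕ) ≤ p then xs ⟨i, by omega⟩
  else cast (congrArg E (show p + ((i : ℕ) - p) = (i : ℕ) by omega))
    (ys ⟨(i : ℕ) - p, by have := i.isLt; omega⟩)

/-- The oscillation `osc(f) = sup_{x,y} |f x - f y|`. -/
def osc {α : Type*} (f : α → ℝ) : ℝ := sSup {d | ∃ x y, d = |f x - f y|}

/-- The Dobrushin contraction coefficient of an operator mapping functions on `α`
to functions on `β`. -/
def betaOp {α β : Type*} [MeasurableSpace α] (T : (α → ℝ) → β → ℝ) : ℝ :=
  sSup {r | ∃ φ : α → ℝ, Measurable φ ∧ (∀ x y, |φ x - φ y| ≤ 1) ∧ r = osc (T φ)}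

/-- Empirical measure of an `N`-tuple. -/
def emp {α : Type*} [MeasurableSpace α] {N : ℕ} (x : Fin N → α) : Measure α :=
  (N : ℝ≥0∞)⁻¹ • ∑ i, Measure.dirac (x i)


universe u

section BackwardDecomposition

variable {M G H}

/-- The Feynman-Kac transition `Qk` as a kernel. -/
def QKernel (hGm : ∀ q, Measurable (G q)) (q : ℕ) : Kernel (E q) (E (q+1)) where
  toFun := Qk M G q
  measurable' := by
    refine Measure.measurable_of_measurable_coe _ fun s hs => ?_
    simp only [Qk, Measure.smul_apply, smul_eq_mul]
    exact (hGm q).ennreal_ofReal.mul (Kernel.measurable_coe _ hs)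

lemma Qk_univ_le_one (hM : ∀ q, IsMarkovKernel (M q)) (hG : ∀ q x, G q x ∈ Set.Ioc (0:ℝ) 1)
    (q : ℕ) (x : E q) : Qk M G q x Set.univ ≤ 1 := by
  simpa [Qk] using (hG q x).2

lemma isFiniteKernel_QKernel (hM : ∀ q, IsMarkovKernel (M q)) (hGm : ∀ q, Measurable (G q))
    (hG : ∀ q x, G q x ∈ Set.Ioc (0:ℝ) 1) (q : ℕ) :
    IsFiniteKernel (QKernel (M := M) hGm q) :=
  ⟨1, one_lt_top, fun x => Qk_univ_le_one hM hG q x⟩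

lemma gamma_succ (hGm : ∀ q, Measurable (G q)) (η0 : Measure (E 0)) (n : ℕ) :
    gamma M G η0 (n+1) = (gamma M G η0 n).bind (QKernel (M := M) hGm n) := rfl

lemma isFiniteMeasure_gamma (hM : ∀ q, IsMarkovKernel (M q)) (hGm : ∀ q, Measurable (G q))
    (hG : ∀ q x, G q x ∈ Set.Ioc (0:ℝ) 1) (η0 : Measure (E 0)) [IsProbabilityMeasure η0] :
    ∀ n, IsFiniteMeasure (gamma M G η0 n)
  | 0 => inferInstanceAs (IsFiniteMeasure η0)
  | n + 1 => by
    have := isFiniteMeasure_gamma hM hGm hG η0 n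
    have := isFiniteKernel_QKernel hM hGm hG n
    rw [gamma_succ hGm]
    infer_instance

lemma gamma_ne_zero (hM : ∀ q, IsMarkovKernel (M q)) (hGm : ∀ q, Measurable (G q))
    (hG : ∀ q x, G q x ∈ Set.Ioc (0:ℝ) 1) (η0 : Measure (E 0)) [IsProbabilityMeasure η0] :
    ∀ n, gamma M G η0 n ≠ 0
  | 0 => IsProbabilityMeasure.ne_zero η0
  | n + 1 => by
    intro h
    refine gamma_ne_zero hM hGm hG η0 n ?_
    have h1 : gamma M G η0 (n+1) Set.univ = 0 := by simp [h]
    rw [gamma_succ hGm, Measure.bind_apply .univ (Kernel.aemeasurable _),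
      lintegral_eq_zero_iff (Kernel.measurable_coe _ .univ)] at h1
    rw [← ae_eq_bot, ← Filter.eventually_false_iff_eq_bot]
    filter_upwards [h1] with x hx
    have := (hG n x).1
    simp [QKernel, Qk] at hx
    linarith

lemma isProbabilityMeasure_nz {α : Type*} [MeasurableSpace α] {μ : Measure α} [IsFiniteMeasure μ]
    (h : μ ≠ 0) : IsProbabilityMeasure (nz μ) :=
  ⟨by
    simp only [nz, Measure.smul_apply, smul_eq_mul]
    exact ENNReal.inv_mul_cancel (by simpa using h) (measure_ne_top _ _)⟩

lemma measurable_potential (hGm : ∀ q, Measurable (G q))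
    (hHm : ∀ q, Measurable (Function.uncurry (H q))) (q : ℕ) :
    Measurable fun z : E q × E (q+1) => ENNReal.ofReal (G q z.1 * H q z.1 z.2) :=
  (((hGm q).comp measurable_fst).mul (hHm q)).ennreal_ofReal

lemma measurable_potential_left (hGm : ∀ q, Measurable (G q))
    (hHm : ∀ q, Measurable (Function.uncurry (H q))) (q : ℕ) (y : E (q+1)) :
    Measurable fun x => ENNReal.ofReal (G q x * H q x y) :=
  (measurable_potential hGm hHm q).comp measurable_prodMk_right

lemma lintegral_Mback (hGm : ∀ q, Measurable (G q))
    (hHm : ∀ q, Measurable (Function.uncurry (H q))) (q : ℕ) (η : Measure (E q)) (y : E (q+1))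
    {f : E q → ℝ≥0∞} (hf : Measurable f) :
    ∫⁻ x, f x ∂(Mback G H q η y) = (∫⁻ x, ENNReal.ofReal (G q x * H q x y) ∂η)⁻¹ *
      ∫⁻ x, ENNReal.ofReal (G q x * H q x y) * f x ∂η := by
  rw [Mback, lintegral_smul_measure, lintegral_withDensity_eq_lintegral_mul _
    (measurable_potential_left hGm hHm q y) hf]
  rfl

/-- The backward transition `Mback` as a kernel. -/
def MbackKernel (hGm : ∀ q, Measurable (G q)) (hHm : ∀ q, Measurable (Function.uncurry (H q)))
    (q : ℕ) (η : Measure (E q)) [SFinite η] : Kernel (E (q+1)) (E q) where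
  toFun := Mback G H q η
  measurable' := by
    refine Measure.measurable_of_measurable_coe _ fun s hs => ?_
    have h := measurable_potential hGm hHm q
    simp_rw [← lintegral_indicator_one hs,
      lintegral_Mback hGm hHm q η _ (measurable_one.indicator hs)]
    have hs' : Measurable fun z : E q × E (q+1) => s.indicator (1 : E q → ℝ≥0∞) z.1 :=
      (measurable_one.indicator hs).comp measurable_fst
    exact h.lintegral_prod_left'.inv.mul (h.mul hs').lintegral_prod_left'

lemma lintegral_potential_ne_zero (hGm : ∀ q, Measurable (G q))
    (hG : ∀ q x, G q x ∈ Set.Ioc (0:ℝ) 1) (hHm : ∀ q, Measurable (Function.uncurry (H q)))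
    (hHpos : ∀ q x y, 0 < H q x y) (q : ℕ) {η : Measure (E q)} (hη : η ≠ 0) (y : E (q+1)) :
    ∫⁻ x, ENNReal.ofReal (G q x * H q x y) ∂η ≠ 0 := by
  intro h
  rw [lintegral_eq_zero_iff (measurable_potential_left hGm hHm q y)] at h
  refine hη ?_
  rw [← ae_eq_bot, ← Filter.eventually_false_iff_eq_bot]
  filter_upwards [h] with x hx
  have := mul_pos (hG q x).1 (hHpos q x y)
  simp at hx
  linarith

lemma isMarkovKernel_MbackKernel (hGm : ∀ q, Measurable (G q))
    (hG : ∀ q x, G q x ∈ Set.Ioc (0:ℝ) 1) (hHm : ∀ q, Measurable (Function.uncurry (H q)))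
    (hHpos : ∀ q x y, 0 < H q x y)
    (hHint : ∀ q (η : Measure (E q)), IsProbabilityMeasure η → ∀ y,
      ∫⁻ x, ENNReal.ofReal (G q x * H q x y) ∂η < ⊤) (q : ℕ) (η : Measure (E q))
    [hη : IsProbabilityMeasure η] : IsMarkovKernel (MbackKernel hGm hHm q η) :=
  ⟨fun y => ⟨by
    change Mback G H q η y Set.univ = 1
    rw [← lintegral_one, lintegral_Mback hGm hHm q η y measurable_const]
    simp only [mul_one]
    exact ENNReal.inv_mul_cancel
      (lintegral_potential_ne_zero hGm hG hHm hHpos q (IsProbabilityMeasure.ne_zero η) y)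
      (hHint q η hη y).ne⟩⟩

lemma Mback_nz (q : ℕ) (γ : Measure (E q)) [IsFiniteMeasure γ] (hγ : γ ≠ 0) :
    Mback G H q (nz γ) = Mback G H q γ := by
  funext y
  have h0 : γ Set.univ ≠ 0 := by simpa using hγ
  have ht : γ Set.univ ≠ ∞ := measure_ne_top _ _
  rw [Mback, Mback, nz, lintegral_smul_measure, withDensity_smul_measure, smul_smul, smul_eq_mul,
    ENNReal.mul_inv (.inl (ENNReal.inv_ne_zero.2 ht)) (.inl (by simpa using h0)), inv_inv, mul_comm,
    ← mul_assoc, ENNReal.inv_mul_cancel h0 ht, one_mul]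

lemma lintegral_lintegral_Qk {lam : ∀ n, Measure (E n)} (hGm : ∀ q, Measurable (G q))
    (hG : ∀ q x, G q x ∈ Set.Ioc (0:ℝ) 1) (hHm : ∀ q, Measurable (Function.uncurry (H q)))
    (hlam : ∀ n, SigmaFinite (lam n))
    (hMH : ∀ q x, (M q x : Measure (E (q+1)))
      = (lam (q+1)).withDensity fun y => ENNReal.ofReal (H q x y))
    (q : ℕ) (γ : Measure (E q)) [SFinite γ] {f : E q × E (q+1) → ℝ≥0∞} (hf : Measurable f) :
    ∫⁻ x, ∫⁻ y, f (x, y) ∂(Qk M G q x) ∂γ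
      = ∫⁻ y, ∫⁻ x, ENNReal.ofReal (G q x * H q x y) * f (x, y) ∂γ ∂(lam (q+1)) := by
  have h : Measurable fun z : E q × E (q+1) => ENNReal.ofReal (G q z.1 * H q z.1 z.2) * f z :=
    (measurable_potential hGm hHm q).mul hf
  rw [← lintegral_lintegral_swap h.aemeasurable]
  refine lintegral_congr fun x => ?_
  have hH : Measurable fun y => ENNReal.ofReal (H q x y) :=
    ((hHm q).comp measurable_prodMk_left).ennreal_ofReal
  have hfx : Measurable fun y => f (x, y) := hf.comp measurable_prodMk_left
  rw [Qk, lintegral_smul_measure, hMH, lintegral_withDensity_eq_lintegral_mul _ hH hfx,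
    smul_eq_mul, ← lintegral_const_mul _ (hH.mul hfx)]
  refine lintegral_congr fun y => ?_
  rw [ENNReal.ofReal_mul (hG q x).1.le, mul_assoc]
  rfl

/-- One-step time reversal: the joint law of two consecutive states. -/
lemma gamma_compProd_QKernel {lam : ∀ n, Measure (E n)} {η0 : Measure (E 0)}
    (hM : ∀ q, IsMarkovKernel (M q))
    (hGm : ∀ q, Measurable (G q)) (hG : ∀ q x, G q x ∈ Set.Ioc (0:ℝ) 1)
    (hHm : ∀ q, Measurable (Function.uncurry (H q)))
    (hHpos : ∀ q x y, 0 < H q x y)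
    (hlam : ∀ n, SigmaFinite (lam n))
    (hMH : ∀ q x, (M q x : Measure (E (q+1)))
      = (lam (q+1)).withDensity fun y => ENNReal.ofReal (H q x y))
    (hHint : ∀ q (η : Measure (E q)), IsProbabilityMeasure η → ∀ y,
      ∫⁻ x, ENNReal.ofReal (G q x * H q x y) ∂η < ⊤)
    [IsProbabilityMeasure η0] (q : ℕ) [IsProbabilityMeasure (nz (gamma M G η0 q))] :
    gamma M G η0 q ⊗ₘ QKernel (M := M) hGm q =
      (gamma M G η0 (q+1) ⊗ₘ MbackKernel hGm hHm q (nz (gamma M G η0 q))).map Prod.swap := by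
  have := isFiniteMeasure_gamma hM hGm hG η0 q
  have := isFiniteMeasure_gamma hM hGm hG η0 (q+1)
  have := isFiniteKernel_QKernel hM hGm hG q
  have := isMarkovKernel_MbackKernel hGm hG hHm hHpos hHint q (nz (gamma M G η0 q))
  have hγ := gamma_ne_zero hM hGm hG η0 q
  have hpot := measurable_potential hGm hHm q
  have hD0 := lintegral_potential_ne_zero hGm hG hHm hHpos q hγ
  have hDt (y : E (q+1)) : ∫⁻ x, ENNReal.ofReal (G q x * H q x y) ∂(gamma M G η0 q) ≠ ∞ := by
    have h := hHint q (nz (gamma M G η0 q)) inferInstance y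
    rw [nz, lintegral_smul_measure, smul_eq_mul] at h
    intro h'
    rw [h', ENNReal.mul_top (by simp)] at h
    exact lt_irrefl _ h
  refine Measure.ext_of_lintegral _ fun f hf => ?_
  rw [Measure.lintegral_compProd hf, lintegral_map hf measurable_swap,
    Measure.lintegral_compProd (f := fun z => f z.swap) (hf.comp measurable_swap)]
  change ∫⁻ x, ∫⁻ y, f (x, y) ∂(Qk M G q x) ∂(gamma M G η0 q) =
    ∫⁻ y, ∫⁻ x, f (x, y) ∂(Mback G H q (nz (gamma M G η0 q)) y) ∂(gamma M G η0 (q+1))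
  simp_rw [Mback_nz q _ hγ, lintegral_Mback hGm hHm q _ _
    (show Measurable fun x => f (x, _) from hf.comp measurable_prodMk_right)]
  have hg : Measurable fun y => (∫⁻ x, ENNReal.ofReal (G q x * H q x y) ∂(gamma M G η0 q))⁻¹ *
      ∫⁻ x, ENNReal.ofReal (G q x * H q x y) * f (x, y) ∂(gamma M G η0 q) :=
    hpot.lintegral_prod_left'.inv.mul (hpot.mul hf).lintegral_prod_left'
  rw [gamma_succ hGm, Measure.lintegral_bind (Kernel.aemeasurable _) hg.aemeasurable]
  refine Eq.trans ?_ (lintegral_lintegral_Qk hGm hG hHm hlam hMH q _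
    (hg.comp measurable_snd)).symm
  rw [lintegral_lintegral_Qk hGm hG hHm hlam hMH q _ hf]
  refine lintegral_congr fun y => ?_
  simp only [Function.comp_apply]
  rw [lintegral_mul_const _ (measurable_potential_left hGm hHm q y), ← mul_assoc,
    ENNReal.mul_inv_cancel (hD0 y) (hDt y), one_mul]

lemma integrable_of_bounded {α : Type*} [MeasurableSpace α] {μ : Measure α} [IsFiniteMeasure μ]
    {f : α → ℝ} (hf : Measurable f) {C : ℝ} (hC : ∀ x, |f x| ≤ C) : Integrable f μ :=
  .of_bound hf.aestronglyMeasurable C (.of_forall hC)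

lemma abs_integral_le_of_measure_univ_le_one {α : Type*} [MeasurableSpace α] {μ : Measure α}
    (hμ : μ Set.univ ≤ 1) {f : α → ℝ} {C : ℝ} (hC0 : 0 ≤ C) (hC : ∀ x, |f x| ≤ C) :
    |∫ x, f x ∂μ| ≤ C := by
  have : IsFiniteMeasure μ := ⟨hμ.trans_lt one_lt_top⟩
  refine (norm_integral_le_of_norm_le_const (f := f) (.of_forall hC)).trans ?_
  exact mul_le_of_le_one_right hC0 (ENNReal.toReal_le_of_le_ofReal zero_le_one (by simpa using hμ))

lemma measurable_snoc (p k : ℕ) :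
    Measurable fun z : (∀ i : Fin (k+1), E (p + ↑i)) × E (p + (k+1)) =>
      (Fin.snoc (α := fun i : Fin (k+2) => E (p + ↑i)) z.1 z.2) := by
  refine measurable_pi_lambda _ fun i => ?_
  induction i using Fin.lastCases with
  | last => simpa using measurable_snd
  | cast i =>
    simp only [Fin.snoc_castSucc]
    exact (measurable_pi_apply i).comp measurable_fst

section BwdSeg

variable {E : ℕ → Type u} [∀ n, MeasurableSpace (E n)] {G : ∀ n, E n → ℝ}
  {H : ∀ n, E n → E (n+1) → ℝ} {θ : ∀ q, Measure (E q)}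

lemma bwdSeg_congr {p k : ℕ} {x : E (p + k)} {F F' : (∀ i : Fin (k+1), E (p + ↑i)) → ℝ}
    (h : ∀ xs, xs (Fin.last k) = x → F xs = F' xs) :
    bwdSeg G H θ p k x F = bwdSeg G H θ p k x F' := by
  cases k with
  | zero => exact h _ rfl
  | succ k =>
    have hs : (fun xs : ∀ i : Fin (k+1), E (p + ↑i) => F (Fin.snoc xs x)) =
        fun xs => F' (Fin.snoc xs x) :=
      funext fun xs => h _ (Fin.snoc_last (α := fun i : Fin (k+2) => E (p + ↑i)) _ _)
    exact congrArg (fun Φ => ∫ y, bwdSeg G H θ p k y Φ ∂(Mback G H (p + k) (θ (p + k)) x)) hs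

lemma abs_bwdSeg_le (hθ : ∀ q x, Mback G H q (θ q) x Set.univ ≤ 1) {p : ℕ} {C : ℝ} (hC : 0 ≤ C) :
    ∀ {k : ℕ} {F : (∀ i : Fin (k+1), E (p + ↑i)) → ℝ}, (∀ xs, |F xs| ≤ C) → ∀ x : E (p + k),
      |bwdSeg G H θ p k x F| ≤ C
  | 0, _, hF, _ => hF _
  | _ + 1, _, hF, _ => abs_integral_le_of_measure_univ_le_one (hθ _ _) hC
      fun y => abs_bwdSeg_le hθ hC (fun _ => hF _) y

lemma measurable_bwdSeg {κ : ∀ q, Kernel (E (q+1)) (E q)} [∀ q, IsMarkovKernel (κ q)]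
    (hκ : ∀ q x, κ q x = Mback G H q (θ q) x) {p : ℕ} {k : ℕ} {α : Type u} [MeasurableSpace α]
    {F : α → (∀ i : Fin (k+1), E (p + ↑i)) → ℝ} (hF : Measurable (Function.uncurry F)) :
    Measurable fun z : α × E (p + k) => bwdSeg G H θ p k z.2 (F z.1) := by
  induction k generalizing α with
  | zero =>
    refine hF.comp (measurable_fst.prodMk (measurable_pi_lambda _ fun i => ?_))
    fin_cases i
    exact measurable_snd
  | succ k ih =>
    have hs : Measurable (Function.uncurry fun (z : α × E (p + (k+1)))
        (xs : ∀ i : Fin (k+1), E (p + ↑i)) =>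
        F z.1 (Fin.snoc (α := fun i : Fin (k+2) => E (p + ↑i)) xs z.2)) :=
      hF.comp ((measurable_fst.comp measurable_fst).prodMk
        ((measurable_snoc p k).comp (measurable_snd.prodMk (measurable_snd.comp measurable_fst))))
    have h' := ((ih hs).stronglyMeasurable.integral_kernel_prod_right'
      (κ := (κ (p + k)).comap Prod.snd measurable_snd)).measurable
    simp only [Kernel.comap_apply, hκ] at h'
    exact h'

lemma bwdSeg_integral {κ : ∀ q, Kernel (E (q+1)) (E q)} [∀ q, IsMarkovKernel (κ q)]
    (hκ : ∀ q x, κ q x = Mback G H q (θ q) x) {p : ℕ} {k : ℕ} {α : Type u} [MeasurableSpace α]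
    (ν : Measure α) [IsFiniteMeasure ν]
    {F : α → (∀ i : Fin (k+1), E (p + ↑i)) → ℝ} (hF : Measurable (Function.uncurry F))
    {C : ℝ} (hC : 0 ≤ C) (hFC : ∀ a xs, |F a xs| ≤ C) (x : E (p + k)) :
    bwdSeg G H θ p k x (fun xs => ∫ a, F a xs ∂ν) = ∫ a, bwdSeg G H θ p k x (F a) ∂ν := by
  induction k with
  | zero => rfl
  | succ k ih =>
    have hs : Measurable (Function.uncurry fun a xs =>
        F a (Fin.snoc (α := fun i : Fin (k+2) => E (p + ↑i)) xs x)) :=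
      hF.comp (measurable_fst.prodMk
        ((measurable_snoc p k).comp (measurable_snd.prodMk measurable_const)))
    have hθ : ∀ q x, Mback G H q (θ q) x Set.univ ≤ 1 := fun q x => by
      rw [← hκ, measure_univ]
    simp only [bwdSeg]
    simp_rw [ih hs fun a xs => hFC a _, ← hκ]
    refine integral_integral_swap (integrable_of_bounded (C := C) ?_ fun z => ?_)
    · exact (measurable_bwdSeg hκ hs).comp measurable_swap
    · exact abs_bwdSeg_le hθ hC (fun _ => hFC _ _) _

end BwdSeg

end BackwardDecomposition

/-- Lemma 4.1, first assertion. For any `0 ≤ p < n` (here `n = p + k`,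
`1 ≤ k`), the measures `γ_p(dx_p) ∏_{p≤q<n} Q_{q+1}(x_q,dx_{q+1})` and
`γ_n(dx_n) ∏_{p≤q<n} M_{q+1,η_q}(x_{q+1},dx_q)` on `E_p × ⋯ × E_n` coincide, i.e. they
integrate every bounded measurable function `F` equally. -/
theorem backward_decomposition_unnormalized
    (lam : ∀ n, Measure (E n)) (η0 : Measure (E 0))
    (hM : ∀ q, IsMarkovKernel (M q))
    (hGm : ∀ q, Measurable (G q)) (hG : ∀ q x, G q x ∈ Set.Ioc (0:ℝ) 1)
    (hHm : ∀ q, Measurable (Function.uncurry (H q)))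
    (hHpos : ∀ q x y, 0 < H q x y)
    (hlam : ∀ n, SigmaFinite (lam n))
    (hMH : ∀ q x, (M q x : Measure (E (q+1)))
      = (lam (q+1)).withDensity fun y => ENNReal.ofReal (H q x y))
    (hHint : ∀ q (η : Measure (E q)), IsProbabilityMeasure η → ∀ y,
      ∫⁻ x, ENNReal.ofReal (G q x * H q x y) ∂η < ⊤)
    (hη0 : IsProbabilityMeasure η0)
    (p k : ℕ) (hk : 1 ≤ k)
    (F : (∀ i : Fin (k+1), E (p + ↑i)) → ℝ) (hFm : Measurable F) (hFb : ∃ C, ∀ x, |F x| ≤ C) :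
    ∫ x, fwdSeg M G p k x F ∂ (gamma M G η0 p)
      = ∫ x, bwdSeg G H (fun q => nz (gamma M G η0 q)) p k x F ∂ (gamma M G η0 (p+k)) := by
  have hC : ∃ C, 0 ≤ C ∧ ∀ x, |F x| ≤ C := by
    obtain ⟨C, hC⟩ := hFb
    exact ⟨max C 0, le_max_right _ _, fun x => (hC x).trans (le_max_left _ _)⟩
  clear hFb hk
  obtain ⟨C, hC0, hC⟩ := hC
  have hγfin := isFiniteMeasure_gamma hM hGm hG η0
  have hη := fun q => isProbabilityMeasure_nz (gamma_ne_zero hM hGm hG η0 q)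
  have hQfin := isFiniteKernel_QKernel hM hGm hG
  have hmark := fun q => isMarkovKernel_MbackKernel hGm hG hHm hHpos hHint q (nz (gamma M G η0 q))
  have hκ : ∀ q x, MbackKernel hGm hHm q (nz (gamma M G η0 q)) x
    = Mback G H q (nz (gamma M G η0 q)) x := fun _ _ => rfl
  have hθ : ∀ q x, Mback G H q (nz (gamma M G η0 q)) x Set.univ ≤ 1 := fun q x => by
    rw [← hκ, measure_univ]
  induction k with
  | zero => rfl
  | succ k ih =>
    have hsnoc := hFm.comp (measurable_snoc p k)
    have hlast : Measurable fun xs : ∀ i : Fin (k+1), E (p + ↑i) => xs (Fin.last k) :=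
      measurable_pi_apply _
    have hF' : Measurable fun xs : ∀ i : Fin (k+1), E (p + ↑i) =>
        ∫ y, F (Fin.snoc xs y) ∂(Qk M G (p + k) (xs (Fin.last k))) :=
      (hsnoc.stronglyMeasurable.integral_kernel_prod_right'
        (κ := (QKernel (M := M) hGm (p + k)).comap _ hlast)).measurable
    have hswap : Measurable (Function.uncurry fun (y : E (p + (k+1)))
        (xs : ∀ i : Fin (k+1), E (p + ↑i)) => F (Fin.snoc xs y)) :=
      hsnoc.comp measurable_swap
    let f : E (p + k) × E (p + k + 1) → ℝ := fun z =>
      bwdSeg G H (fun q => nz (gamma M G η0 q)) p k z.1 fun xs => F (Fin.snoc xs z.2)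
    have hf : Measurable f := (measurable_bwdSeg hκ hswap).comp measurable_swap
    have hfC : ∀ z, |f z| ≤ C := fun z => abs_bwdSeg_le hθ hC0 (fun _ => hC _) _
    have hstep : ∀ x, bwdSeg G H (fun q => nz (gamma M G η0 q)) p k x
        (fun xs => ∫ y, F (Fin.snoc xs y) ∂(Qk M G (p + k) (xs (Fin.last k))))
        = ∫ y, f (x, y) ∂(QKernel (M := M) hGm (p + k) x) := fun x =>
      (bwdSeg_congr fun xs h => by rw [h]; rfl).trans
        (bwdSeg_integral hκ (QKernel (M := M) hGm (p + k) x) hswap hC0 (fun _ _ => hC _) x)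
    simp only [fwdSeg]
    rw [ih _ hF' fun xs =>
      abs_integral_le_of_measure_univ_le_one (Qk_univ_le_one hM hG _ _) hC0 fun _ => hC _]
    simp_rw [hstep]
    rw [← Measure.integral_compProd (integrable_of_bounded hf hfC),
      gamma_compProd_QKernel hM hGm hG hHm hHpos hlam hMH hHint (p + k),
      integral_map measurable_swap.aemeasurable hf.aestronglyMeasurable,
      Measure.integral_compProd (f := fun z => f z.swap)
        (integrable_of_bounded (hf.comp measurable_swap) fun z => hfC z.swap)]
    rfl

end
end

section
/- Local backward equation: for any n ≥ 0 and any probability measure η on E_n, the following two measures on E_n × E_{n+1} coincide: η(dx) Q_{n+1}(x,dy) = (ηQ_{n+1})(dy) M_{n+1,η}(y,dx). -/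
open MeasureTheory ProbabilityTheory ENNReal

noncomputable section

variable {E : ℕ → Type*} [∀ n, MeasurableSpace (E n)]

variable (M : ∀ n, Kernel (E n) (E (n+1))) (G : ∀ n, E n → ℝ) (H : ∀ n, E n → E (n+1) → ℝ)

/-- Each kernel `Q_{q+1}` has density `G_q(x) H_{q+1}(x,y)` when `M_{q+1}` has density `H_{q+1}`. -/
lemma Qk_eq_withDensity {q : ℕ} {μ : Measure (E (q+1))} {x : E q} (hGx : 0 ≤ G q x)
    (hHm : Measurable (H q x))
    (hM : (M q x : Measure (E (q+1))) = μ.withDensity fun y => ENNReal.ofReal (H q x y)) :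
    Qk M G q x = μ.withDensity fun y => ENNReal.ofReal (G q x * H q x y) := by
  rw [Qk, hM, ← withDensity_smul _ hHm.ennreal_ofReal]
  congr 1
  ext y
  simp [ENNReal.ofReal_mul hGx]

/-- Mixing densities: if `κ x = g(x,·) μ`, then `η κ` has density `y ↦ η(g(·,y))`. -/
lemma bind_withDensity_eq {α β : Type*} [MeasurableSpace α] [MeasurableSpace β]
    {η : Measure α} [SFinite η] {μ : Measure β} [SFinite μ] {κ : α → Measure β}
    {g : α × β → ℝ≥0∞} (hg : Measurable g) (hκm : Measurable κ)
    (hκ : ∀ x, κ x = μ.withDensity fun y => g (x, y)) :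
    η.bind κ = μ.withDensity fun y => ∫⁻ x, g (x, y) ∂η := by
  ext s hs
  simp_rw [Measure.bind_apply hs hκm.aemeasurable, hκ, withDensity_apply _ hs]
  exact lintegral_lintegral_swap (f := fun x y => g (x, y)) hg.aemeasurable

/-- local backward equation. For any `n ≥ 0` and any probability measure `η`
on `E_n`, the measures `η(dx) Q_{n+1}(x,dy)` and `(ηQ_{n+1})(dy) M_{n+1,η}(y,dx)` on
`E_n × E_{n+1}` coincide, i.e. they integrate every bounded measurable function equally. -/
theorem local_backward_equation
    (lam : ∀ n, Measure (E n))
    (hM : ∀ q, IsMarkovKernel (M q))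
    (hGm : ∀ q, Measurable (G q)) (hG : ∀ q x, G q x ∈ Set.Ioc (0:ℝ) 1)
    (hHm : ∀ q, Measurable (Function.uncurry (H q)))
    (hHpos : ∀ q x y, 0 < H q x y)
    (hlam : ∀ n, SigmaFinite (lam n))
    (hMH : ∀ q x, (M q x : Measure (E (q+1)))
      = (lam (q+1)).withDensity fun y => ENNReal.ofReal (H q x y))
    (hHint : ∀ q (η : Measure (E q)), IsProbabilityMeasure η → ∀ y,
      ∫⁻ x, ENNReal.ofReal (G q x * H q x y) ∂η < ⊤)
    (n : ℕ) (η : Measure (E n)) (hη : IsProbabilityMeasure η)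
    (F : E n × E (n+1) → ℝ) (hFm : Measurable F) (hFb : ∃ C, ∀ z, |F z| ≤ C) :
    ∫ x, (∫ y, F (x, y) ∂ (Qk M G n x)) ∂ η
      = ∫ y, (∫ x, F (x, y) ∂ (Mback G H n η y)) ∂ (η.bind (Qk M G n)) := by
  obtain ⟨C, hC⟩ := hFb
  have := hlam (n+1)
  have hgm : Measurable fun z : E n × E (n+1) => G n z.1 * H n z.1 z.2 :=
    ((hGm n).comp measurable_fst).mul (hHm n)
  have hgx : ∀ x, Measurable fun y => ENNReal.ofReal (G n x * H n x y) := fun x =>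
    (hgm.comp measurable_prodMk_left).ennreal_ofReal
  have hgy : ∀ y, Measurable fun x => ENNReal.ofReal (G n x * H n x y) := fun y =>
    (hgm.comp measurable_prodMk_right).ennreal_ofReal
  have hgpos : ∀ x y, 0 < G n x * H n x y := fun x y => mul_pos (hG n x).1 (hHpos n x y)
  have hQ : ∀ x, Qk M G n x
      = (lam (n+1)).withDensity fun y => ENNReal.ofReal (G n x * H n x y) := fun x =>
    Qk_eq_withDensity M G H (hG n x).1.le ((hHm n).comp measurable_prodMk_left) (hMH n x)
  have hQm : Measurable (Qk M G n) := by
    refine Measure.measurable_of_measurable_coe _ fun s hs => ?_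
    simp only [Qk, Measure.smul_apply, smul_eq_mul]
    exact (hGm n).ennreal_ofReal.mul ((M n).measurable_coe hs)
  have hintG : Integrable (fun z : E n × E (n+1) => G n z.1 * H n z.1 z.2)
      (η.prod (lam (n+1))) := by
    refine ⟨hgm.aestronglyMeasurable, ?_⟩
    rw [hasFiniteIntegral_iff_ofReal (.of_forall fun z : E n × E (n+1) => (hgpos z.1 z.2).le),
      lintegral_prod _ hgm.ennreal_ofReal.aemeasurable]
    calc ∫⁻ x, ∫⁻ y, ENNReal.ofReal (G n x * H n x y) ∂lam (n+1) ∂η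
        ≤ ∫⁻ _, 1 ∂η := by
          refine lintegral_mono fun x => ?_
          rw [← setLIntegral_univ, ← withDensity_apply _ MeasurableSet.univ, ← hQ]
          simpa [Qk] using (hG n x).2
      _ < ⊤ := by simp
  have hintF : Integrable (fun z : E n × E (n+1) => G n z.1 * H n z.1 z.2 * F z)
      (η.prod (lam (n+1))) :=
    hintG.mul_bdd hFm.aestronglyMeasurable (ae_of_all _ hC)
  rw [bind_withDensity_eq hgm.ennreal_ofReal hQm hQ]
  have hh0 : ∀ y, ∫⁻ x, ENNReal.ofReal (G n x * H n x y) ∂η ≠ 0 := fun y h => by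
    rw [lintegral_eq_zero_iff (hgy y)] at h
    obtain ⟨x, hx⟩ := h.exists
    simp [(hgpos x y).not_ge] at hx
  rw [integral_withDensity_eq_integral_toReal_smul
    hgm.ennreal_ofReal.lintegral_prod_left' (ae_of_all _ (hHint n η hη))]
  have hleft : ∀ x, ∫ y, F (x, y) ∂(Qk M G n x)
      = ∫ y, G n x * H n x y * F (x, y) ∂lam (n+1) := fun x => by
    rw [hQ, integral_withDensity_eq_integral_toReal_smul
      (hgx x) (ae_of_all _ fun _ => ofReal_lt_top)]
    simp [ENNReal.toReal_ofReal (hgpos x _).le]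
  have hright : ∀ y, (∫⁻ x, ENNReal.ofReal (G n x * H n x y) ∂η).toReal
        • ∫ x, F (x, y) ∂(Mback G H n η y)
      = ∫ x, G n x * H n x y * F (x, y) ∂η := fun y => by
    rw [Mback, integral_smul_measure, integral_withDensity_eq_integral_toReal_smul
      (hgy y) (ae_of_all _ fun _ => ofReal_lt_top),
      smul_smul, ← ENNReal.toReal_mul, ENNReal.mul_inv_cancel (hh0 y) (hHint n η hη y).ne]
    simp [ENNReal.toReal_ofReal (hgpos _ y).le]
  simp_rw [hleft, hright]
  exact integral_integral_swap hintF

end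
end

section
/- Duality formula: for any n ≥ 0, any probability measure η on E_n, and any bounded measurable functions f on E_n and g on E_{n+1}, one has Ψ_{G_n}(η)( f · M_{n+1}(g) ) = Φ_{n+1}(η)( g · M_{n+1,η}(f) ). -/
open MeasureTheory ProbabilityTheory ENNReal

noncomputable section

variable {E : ℕ → Type*} [∀ n, MeasurableSpace (E n)]

variable (M : ∀ n, Kernel (E n) (E (n+1))) (G : ∀ n, E n → ℝ) (H : ∀ n, E n → E (n+1) → ℝ)

/-- Applying a kernel with densities `k x` to a measure gives the measure with the averaged
density. -/
theorem bind_eq_withDensity_lintegral {α β : Type*} [MeasurableSpace α] [MeasurableSpace β]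
    {μ : Measure α} [SFinite μ] {ν : Measure β} [SFinite ν] {κ : Kernel α β}
    {k : α → β → ℝ≥0∞} (hk : Measurable (Function.uncurry k))
    (hκ : ∀ x, κ x = ν.withDensity (k x)) :
    μ.bind (fun x => κ x) = ν.withDensity fun y => ∫⁻ x, k x y ∂μ := by
  ext s hs
  rw [Measure.bind_apply hs κ.measurable.aemeasurable, withDensity_apply _ hs]
  simp only [hκ, withDensity_apply _ hs]
  exact lintegral_lintegral_swap hk.aemeasurable

/-- Exchanging the order of integration of a bounded function against the joint law of a
weighted probability measure and a Markov kernel with densities. -/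
theorem integral_mul_integral_density_swap {α β : Type*} [MeasurableSpace α] [MeasurableSpace β]
    {μ : Measure α} [IsFiniteMeasure μ] {ν : Measure β} [SFinite ν] {w : α → ℝ} {k : α → β → ℝ}
    (hwm : Measurable w) (hw : ∀ x, w x ∈ Set.Ioc (0 : ℝ) 1)
    (hkm : Measurable (Function.uncurry k)) (hk : ∀ x y, 0 < k x y)
    (hk1 : ∀ x, ∫⁻ y, ENNReal.ofReal (k x y) ∂ν = 1)
    {f : α → ℝ} (hfm : Measurable f) (hfb : ∃ C, ∀ x, |f x| ≤ C)
    {g : β → ℝ} (hgm : Measurable g) (hgb : ∃ C, ∀ y, |g y| ≤ C) :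
    ∫ x, w x * (f x * ∫ y, k x y * g y ∂ν) ∂μ
      = ∫ y, g y * ∫ x, w x * k x y * f x ∂μ ∂ν := by
  obtain ⟨C, hC⟩ := hfb
  obtain ⟨D, hD⟩ := hgb
  have hkint : Integrable (Function.uncurry k) (μ.prod ν) := by
    refine ⟨hkm.aestronglyMeasurable, ?_⟩
    rw [hasFiniteIntegral_iff_ofReal
        (ae_of_all _ fun p : α × β => (hk p.1 p.2).le : 0 ≤ᵐ[μ.prod ν] Function.uncurry k),
      lintegral_prod _ (by fun_prop)]
    simp [Function.uncurry, hk1]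
  have hint : Integrable (Function.uncurry fun x y => (w x * f x * g y) * k x y) (μ.prod ν) := by
    refine hkint.bdd_mul (c := C * D) (f := fun p : α × β => w p.1 * f p.1 * g p.2)
      (by fun_prop) (ae_of_all _ fun p => ?_)
    rw [Real.norm_eq_abs, abs_mul, abs_mul, abs_of_pos (hw p.1).1]
    have h1 := (hw p.1).1
    have h2 := (hw p.1).2
    have h3 := hC p.1
    have h4 := hD p.2
    have h5 : w p.1 * |f p.1| ≤ C := by
      nlinarith [abs_nonneg (f p.1)]
    exact mul_le_mul h5 h4 (abs_nonneg _) ((abs_nonneg _).trans h3)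
  calc ∫ x, w x * (f x * ∫ y, k x y * g y ∂ν) ∂μ
      = ∫ x, ∫ y, (w x * f x * g y) * k x y ∂ν ∂μ := by
        refine integral_congr_ae (ae_of_all _ fun x => ?_)
        simp only [← integral_const_mul]
        exact integral_congr_ae (ae_of_all _ fun y => by ring)
    _ = ∫ y, ∫ x, (w x * f x * g y) * k x y ∂μ ∂ν := integral_integral_swap hint
    _ = ∫ y, g y * ∫ x, w x * k x y * f x ∂μ ∂ν := by
        refine integral_congr_ae (ae_of_all _ fun y => ?_)
        simp only [← integral_const_mul]
        exact integral_congr_ae (ae_of_all _ fun x => by ring)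

theorem integral_withDensity_ofReal {α : Type*} [MeasurableSpace α] {μ : Measure α}
    {w : α → ℝ} (hwm : Measurable w) (hw : ∀ x, 0 ≤ w x) (f : α → ℝ) :
    ∫ x, f x ∂(μ.withDensity fun x => ENNReal.ofReal (w x)) = ∫ x, w x * f x ∂μ := by
  rw [integral_withDensity_eq_integral_toReal_smul (by fun_prop) (by simp)]
  simp [ENNReal.toReal_ofReal, hw]

/-- duality formula. For any `n ≥ 0`, any probability measure `η` on `E_n`
and bounded measurable `f`, `g`:
`Ψ_{G_n}(η)(f · M_{n+1}(g)) = Φ_{n+1}(η)(g · M_{n+1,η}(f))`. -/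
theorem duality_formula
    (lam : ∀ n, Measure (E n))
    (hM : ∀ q, IsMarkovKernel (M q))
    (hGm : ∀ q, Measurable (G q)) (hG : ∀ q x, G q x ∈ Set.Ioc (0:ℝ) 1)
    (hHm : ∀ q, Measurable (Function.uncurry (H q)))
    (hHpos : ∀ q x y, 0 < H q x y)
    (hlam : ∀ n, SigmaFinite (lam n))
    (hMH : ∀ q x, (M q x : Measure (E (q+1)))
      = (lam (q+1)).withDensity fun y => ENNReal.ofReal (H q x y))
    (hHint : ∀ q (η : Measure (E q)), IsProbabilityMeasure η → ∀ y,
      ∫⁻ x, ENNReal.ofReal (G q x * H q x y) ∂η < ⊤)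
    (n : ℕ) (η : Measure (E n)) (hη : IsProbabilityMeasure η)
    (f : E n → ℝ) (hfm : Measurable f) (hfb : ∃ C, ∀ x, |f x| ≤ C)
    (g : E (n+1) → ℝ) (hgm : Measurable g) (hgb : ∃ C, ∀ y, |g y| ≤ C) :
    ∫ x, (f x * ∫ y, g y ∂ (M n x : Measure (E (n+1)))) ∂ (PsiG G n η)
      = ∫ y, (g y * ∫ x, f x ∂ (Mback G H n η y)) ∂ (Phi M G n η) := by
  have := hM n
  have := hlam (n + 1)
  have hGpos : ∀ x, 0 < G n x := fun x => (hG n x).1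
  have hGn := hGm n
  have hHn := hHm n
  have hHy : ∀ y, Measurable fun x => H n x y := fun y => hHn.of_uncurry_right
  have hHx : ∀ x, Measurable (H n x) := fun x => hHn.of_uncurry_left
  have hk1 : ∀ x, ∫⁻ y, ENNReal.ofReal (H n x y) ∂(lam (n + 1)) = 1 := fun x => by
    rw [← setLIntegral_univ, ← withDensity_apply _ .univ, ← hMH, measure_univ]
  have hGH : Measurable fun p : E n × E (n + 1) => ENNReal.ofReal (G n p.1 * H n p.1 p.2) :=
    ((hGn.comp measurable_fst).mul hHn).ennreal_ofReal
  set c := ∫⁻ x, ENNReal.ofReal (G n x) ∂η with hc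
  set h : E (n + 1) → ℝ≥0∞ := fun y => ∫⁻ x, ENNReal.ofReal (G n x * H n x y) ∂η with hh
  have hhm : Measurable h := hGH.lintegral_prod_left'
  have hh_top : ∀ y, h y < ⊤ := hHint n η hη
  have hh_pos : ∀ y, h y ≠ 0 := fun y => by
    refine (lintegral_pos_iff_support (by fun_prop)).2 ?_ |>.ne'
    simp [Function.support, mul_pos (hGpos _) (hHpos n _ y)]
  have hPhi : Phi M G n η = c⁻¹ • (lam (n + 1)).withDensity h := by
    rw [Phi, PsiG, bind_eq_withDensity_lintegral (ν := lam (n + 1))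
      (k := fun x y => ENNReal.ofReal (H n x y)) hHn.ennreal_ofReal (hMH n),
      ← withDensity_smul _ hhm]
    congr 1 with y
    rw [lintegral_smul_measure, lintegral_withDensity_eq_lintegral_mul _ (by fun_prop)
      (hHy y).ennreal_ofReal]
    simp [hh, ENNReal.ofReal_mul (hGpos _).le, hc]
  rw [hPhi, PsiG, integral_smul_measure, integral_smul_measure,
    integral_withDensity_ofReal hGn (fun x => (hGpos x).le),
    integral_withDensity_eq_integral_toReal_smul hhm (ae_of_all _ hh_top)]
  congr 1
  have hMg : ∀ x, ∫ y, g y ∂(M n x : Measure (E (n + 1)))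
      = ∫ y, H n x y * g y ∂(lam (n + 1)) := fun x => by
    rw [hMH, integral_withDensity_ofReal (hHx x) fun y => (hHpos n x y).le]
  simp only [hMg]
  rw [integral_mul_integral_density_swap hGn (hG n) hHn (hHpos n) hk1 hfm hfb hgm hgb]
  refine integral_congr_ae (ae_of_all _ fun y => ?_)
  have hy : (h y).toReal ≠ 0 := ENNReal.toReal_ne_zero.2 ⟨hh_pos y, (hh_top y).ne⟩
  have hback : ∫ x, f x ∂(Mback G H n η y)
      = (h y).toReal⁻¹ * ∫ x, G n x * H n x y * f x ∂η := by
    rw [Mback, integral_smul_measure, ENNReal.toReal_inv, smul_eq_mul,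
      integral_withDensity_ofReal (w := fun x => G n x * H n x y) (hGn.mul (hHy y)) fun x =>
        (mul_pos (hGpos x) (hHpos n x y)).le]
  simp only [hback, smul_eq_mul]
  field_simp


end
end

section
/- Path-space semigroup formula: for any 0 ≤ p ≤ n and any bounded measurable function F_n on E_0 × ⋯ × E_n, Γ_n(F_n) = γ_p(D_{p,n}(F_n)) and ℚ_n(F_n) = η_p(D_{p,n}(F_n)) / η_p(D_{p,n}(1)), where D_{p,n}(F_n)(x_p) := ∫ ∏_{q=1}^{p} M_{q,η_{q-1}}(x_q, dx_{q-1}) ∏_{p≤q<n} Q_{q+1}(x_q, dx_{q+1}) F_n(x_0,…,x_n). -/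
open MeasureTheory ProbabilityTheory ENNReal

noncomputable section

variable {E : ℕ → Type*} [∀ n, MeasurableSpace (E n)]

variable (M : ∀ n, Kernel (E n) (E (n+1))) (G : ∀ n, E n → ℝ) (H : ∀ n, E n → E (n+1) → ℝ)

section PathSpaceSemigroup

/-- Bounded measurable real functions. -/
def BoundedMeasurable {α : Type*} [MeasurableSpace α] (f : α → ℝ) : Prop :=
  Measurable f ∧ ∃ C, ∀ x, |f x| ≤ C

lemma BoundedMeasurable.comp {α β : Type*} [MeasurableSpace α] [MeasurableSpace β] {f : β → ℝ}
    (hf : BoundedMeasurable f) {g : α → β} (hg : Measurable g) :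
    BoundedMeasurable fun x => f (g x) :=
  ⟨hf.1.comp hg, hf.2.imp fun _ h x => h (g x)⟩

lemma BoundedMeasurable.integrable {α : Type*} [MeasurableSpace α] {f : α → ℝ}
    (hf : BoundedMeasurable f) (μ : Measure α) [IsFiniteMeasure μ] : Integrable f μ := by
  obtain ⟨hm, C, hC⟩ := hf
  exact Integrable.of_bound hm.aestronglyMeasurable C (ae_of_all _ hC)

lemma BoundedMeasurable.integral_bind {α β : Type*} [MeasurableSpace α] [MeasurableSpace β]
    {f : β → ℝ} (hf : BoundedMeasurable f) (μ : Measure α) [IsFiniteMeasure μ]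
    (κ : Kernel α β) [IsFiniteKernel κ] :
    ∫ y, f y ∂(μ.bind κ) = ∫ x, ∫ y, f y ∂(κ x) ∂μ := by
  have h := Kernel.integral_comp (η := κ) (κ := Kernel.const Unit μ) (a := ()) (f := f)
    (hf.integrable _)
  simpa [Kernel.comp_apply] using h

lemma BoundedMeasurable.integral_kernel {α β : Type*} [MeasurableSpace α] [MeasurableSpace β]
    {f : α × β → ℝ} (hf : BoundedMeasurable f) (κ : Kernel α β) [IsFiniteKernel κ] :
    BoundedMeasurable fun x => ∫ y, f (x, y) ∂(κ x) := by
  obtain ⟨hm, C, hC⟩ := hf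
  refine ⟨(hm.stronglyMeasurable.integral_kernel_prod_right' (κ := κ)).measurable,
    |C| * κ.bound.toReal, fun x => ?_⟩
  have hx : ∀ y, ‖f (x, y)‖ ≤ |C| := fun y => (hC (x, y)).trans (le_abs_self C)
  refine (norm_integral_le_of_norm_le_const (ae_of_all _ hx)).trans ?_
  gcongr
  exact ENNReal.toReal_mono κ.bound_ne_top (κ.measure_le_bound x _)

/-- The law of `s X y`, where `X` has law `κ y`, is a Markov kernel in `y`. -/
lemma exists_kernel_map_section {β P P' : Type*} [MeasurableSpace β] [MeasurableSpace P]
    [MeasurableSpace P'] (κ : Kernel β P) [IsMarkovKernel κ] {s : P → β → P'}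
    (hs : Measurable (Function.uncurry s)) :
    ∃ B : Kernel β P', IsMarkovKernel B ∧ ∀ y, B y = (κ y).map fun x => s x y := by
  have hs' : Measurable fun z : β × P => s z.2 z.1 := hs.comp measurable_swap
  refine ⟨(Kernel.id ×ₖ κ).map fun z => s z.2 z.1, Kernel.IsMarkovKernel.map _ hs', fun y => ?_⟩
  rw [Kernel.map_apply _ hs', Kernel.prod_apply, Kernel.id_apply, Measure.dirac_prod,
    Measure.map_map hs' (by fun_prop)]
  rfl

/-- The backward disintegration of one Feynman-Kac step with transition density `g`. -/
lemma map_compProd_eq_bind_backward {α β P P' : Type*} [MeasurableSpace α] [MeasurableSpace β]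
    [MeasurableSpace P] [MeasurableSpace P']
    {lam : Measure β} [SigmaFinite lam] {γ : Measure α} [IsFiniteMeasure γ] (hγ : γ ≠ 0)
    {g : α → β → ℝ≥0∞} (hg : Measurable (Function.uncurry g))
    (hg0 : ∀ y, ∫⁻ x, g x y ∂γ ≠ 0) (hgtop : ∀ y, ∫⁻ x, g x y ∂γ ≠ ∞)
    {Q : Kernel α β} [IsFiniteKernel Q] (hQ : ∀ x, Q x = lam.withDensity (g x))
    {N : Kernel β α}
    (hN : ∀ y, N y = (∫⁻ x, g x y ∂(nz γ))⁻¹ • (nz γ).withDensity fun x => g x y)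
    {B : Kernel α P} [IsFiniteKernel B] {l : P → α} (hl : Measurable l)
    (hB : ∀ x, ∀ φ : α × P → ℝ≥0∞, Measurable φ →
      ∫⁻ z, φ (l z, z) ∂(B x) = ∫⁻ z, φ (x, z) ∂(B x))
    {s : P → β → P'} (hs : Measurable (Function.uncurry s))
    {B' : Kernel β P'} (hB' : ∀ y, B' y = ((N y).bind B).map fun z => s z y) :
    ((γ.bind B) ⊗ₘ (Q.comap l hl)).map (Function.uncurry s) = (γ.bind Q).bind B' := by
  refine Measure.ext_of_lintegral _ fun F hF => ?_
  have hFs : Measurable fun z : P × β => F (s z.1 z.2) := hF.comp hs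
  have hgx : ∀ x, Measurable (g x) := fun x => hg.of_uncurry_left
  have hgy : ∀ y, Measurable fun x => g x y := fun y => hg.of_uncurry_right
  have hFy : ∀ y, Measurable fun z => F (s z y) := fun y =>
    hFs.comp (measurable_id.prodMk measurable_const)
  have hK : Measurable fun z : α × β => ∫⁻ w, F (s w z.2) ∂(B z.1) := by
    have h : Measurable fun z : (α × β) × P => F (s z.2 z.1.2) :=
      hFs.comp (measurable_snd.prodMk (measurable_snd.comp measurable_fst))
    exact h.lintegral_kernel_prod_right' (κ := B.comap (Prod.fst : α × β → α) measurable_fst)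
  have hKy : ∀ y, Measurable fun x => ∫⁻ w, F (s w y) ∂(B x) := fun y =>
    hK.comp (measurable_id.prodMk measurable_const)
  have hKx : ∀ x, Measurable fun y => ∫⁻ w, F (s w y) ∂(B x) := fun x =>
    hK.comp (measurable_const.prodMk measurable_id)
  have hgK : Measurable fun z : α × β => g z.1 z.2 * ∫⁻ w, F (s w z.2) ∂(B z.1) := hg.mul hK
  have hB'F : ∀ y, ∫⁻ z, F z ∂(B' y) = ∫⁻ x, ∫⁻ w, F (s w y) ∂(B x) ∂(N y) := fun y => by
    have hsy : Measurable fun z => s z y := hs.comp (measurable_id.prodMk measurable_const)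
    rw [hB', lintegral_map hF hsy,
      Measure.lintegral_bind B.measurable.aemeasurable (hFy y).aemeasurable]
  have hJ : Measurable fun y => ∫⁻ z, F z ∂(B' y) := hF.lintegral_kernel
  have key : ∀ y, (∫⁻ x, g x y ∂γ) * ∫⁻ z, F z ∂(B' y)
      = ∫⁻ x, g x y * ∫⁻ w, F (s w y) ∂(B x) ∂γ := fun y => by
    have hc0 : (γ Set.univ)⁻¹ ≠ 0 := ENNReal.inv_ne_zero.2 (measure_ne_top _ _)
    have hct : (γ Set.univ)⁻¹ ≠ ∞ := ENNReal.inv_ne_top.2 (by simpa using hγ)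
    rw [hB'F, hN, lintegral_smul_measure,
      lintegral_withDensity_eq_lintegral_mul _ (hgy y) (hKy y), nz, lintegral_smul_measure,
      lintegral_smul_measure]
    simp only [smul_eq_mul, Pi.mul_apply]
    rw [ENNReal.mul_inv (Or.inl hc0) (Or.inl hct)]
    set a := ∫⁻ x, g x y ∂γ
    set c := (γ Set.univ)⁻¹
    set b := ∫⁻ x, g x y * ∫⁻ w, F (s w y) ∂(B x) ∂γ
    calc a * (c⁻¹ * a⁻¹ * (c * b)) = (a * a⁻¹) * (c * c⁻¹) * b := by ring
      _ = _ := by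
        rw [ENNReal.mul_inv_cancel (hg0 y) (hgtop y), ENNReal.mul_inv_cancel hc0 hct, one_mul,
          one_mul]
  have hin : Measurable fun z : α × P => ∫⁻ y, F (s z.2 y) ∂(Q z.1) := by
    have h : Measurable fun z : (α × P) × β => F (s z.1.2 z.2) :=
      hFs.comp ((measurable_snd.comp measurable_fst).prodMk measurable_snd)
    exact h.lintegral_kernel_prod_right' (κ := Q.comap (Prod.fst : α × P → α) measurable_fst)
  have hin' : Measurable fun z : P => ∫⁻ y, F (s z y) ∂(Q (l z)) :=
    hin.comp (hl.prodMk measurable_id)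
  calc ∫⁻ z, F z ∂((γ.bind B) ⊗ₘ (Q.comap l hl)).map (Function.uncurry s)
      = ∫⁻ z, ∫⁻ y, F (s z y) ∂(Q (l z)) ∂(γ.bind B) := by
        rw [lintegral_map hF hs]
        exact Measure.lintegral_compProd (hF.comp hs)
    _ = ∫⁻ x, ∫⁻ z, ∫⁻ y, F (s z y) ∂(Q (l z)) ∂(B x) ∂γ :=
        Measure.lintegral_bind B.measurable.aemeasurable hin'.aemeasurable
    _ = ∫⁻ x, ∫⁻ z, ∫⁻ y, F (s z y) ∂(Q x) ∂(B x) ∂γ :=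
        lintegral_congr fun x => hB x _ hin
    _ = ∫⁻ x, ∫⁻ y, g x y * ∫⁻ z, F (s z y) ∂(B x) ∂lam ∂γ := by
        refine lintegral_congr fun x => ?_
        rw [lintegral_lintegral_swap hFs.aemeasurable, hQ,
          lintegral_withDensity_eq_lintegral_mul _ (hgx x) (hKx x)]
        rfl
    _ = ∫⁻ y, ∫⁻ x, g x y * ∫⁻ z, F (s z y) ∂(B x) ∂γ ∂lam :=
        lintegral_lintegral_swap hgK.aemeasurable
    _ = ∫⁻ y, ∫⁻ x, g x y * ∫⁻ z, F z ∂(B' y) ∂γ ∂lam := by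
        refine lintegral_congr fun y => ?_
        rw [← key y, lintegral_mul_const _ (hgy y)]
    _ = ∫⁻ x, ∫⁻ y, g x y * ∫⁻ z, F z ∂(B' y) ∂lam ∂γ :=
        (lintegral_lintegral_swap (hg.mul (hJ.comp measurable_snd)).aemeasurable).symm
    _ = ∫⁻ x, ∫⁻ y, ∫⁻ z, F z ∂(B' y) ∂(Q x) ∂γ := by
        refine lintegral_congr fun x => ?_
        rw [hQ, lintegral_withDensity_eq_lintegral_mul _ (hgx x) hJ]
        rfl
    _ = ∫⁻ z, F z ∂((γ.bind Q).bind B') := by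
        rw [Measure.lintegral_bind B'.measurable.aemeasurable hF.aemeasurable,
          Measure.lintegral_bind Q.measurable.aemeasurable hJ.aemeasurable]

lemma measurable_path_snoc (n : ℕ) :
    Measurable (Function.uncurry fun (xs : ∀ i : Fin (n+1), E ↑i) (y : E (n+1)) =>
      (Fin.snoc xs y : ∀ i : Fin (n+1+1), E ↑i)) := by
  refine measurable_pi_iff.2 fun i => ?_
  refine Fin.lastCases ?_ (fun j => ?_) i
  · simpa [Function.uncurry_def] using measurable_snd
  · simp only [Function.uncurry_def, Fin.snoc_castSucc]
    exact (measurable_pi_apply j).comp measurable_fst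

lemma exists_kernel_Qk {q : ℕ} (hM : IsMarkovKernel (M q)) (hGm : Measurable (G q))
    (hG : ∀ x, G q x ∈ Set.Ioc (0:ℝ) 1) :
    ∃ Q : Kernel (E q) (E (q+1)), IsFiniteKernel Q ∧ ∀ x, Q x = Qk M G q x := by
  have hm : Measurable (Function.uncurry fun (x : E q) (_ : E (q+1)) => ENNReal.ofReal (G q x)) :=
    (hGm.comp measurable_fst).ennreal_ofReal
  refine ⟨(M q).withDensity fun x _ => ENNReal.ofReal (G q x),
    Kernel.isFiniteKernel_withDensity_of_bounded _ ENNReal.one_ne_top fun x _ => ?_, fun x => ?_⟩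
  · exact ENNReal.ofReal_le_one.2 (hG x).2
  · rw [Kernel.withDensity_apply _ hm, withDensity_const, Qk]

lemma gamma_finite_ne_zero (η0 : Measure (E 0)) (hη0 : IsProbabilityMeasure η0)
    (hM : ∀ q, IsMarkovKernel (M q)) (hGm : ∀ q, Measurable (G q))
    (hG : ∀ q x, G q x ∈ Set.Ioc (0:ℝ) 1) (n : ℕ) :
    IsFiniteMeasure (gamma M G η0 n) ∧ gamma M G η0 n ≠ 0 := by
  induction n with
  | zero => exact ⟨inferInstanceAs (IsFiniteMeasure η0), IsProbabilityMeasure.ne_zero η0⟩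
  | succ n ih =>
    obtain ⟨hfin, hne⟩ := ih
    obtain ⟨Q, hQfin, hQ⟩ := exists_kernel_Qk M G (hM n) (hGm n) (hG n)
    have hQ' : Qk M G n = Q := funext fun x => (hQ x).symm
    have hγ : gamma M G η0 (n+1) = (gamma M G η0 n).bind Q := by rw [gamma, hQ']
    rw [hγ]
    refine ⟨inferInstance, fun h0 => hne ?_⟩
    have hu : ((gamma M G η0 n).bind Q) Set.univ = 0 := by simp [h0]
    rw [Measure.bind_apply MeasurableSet.univ Q.measurable.aemeasurable] at hu
    have hQu : ∀ x, Q x Set.univ = ENNReal.ofReal (G n x) := fun x => by simp [hQ, Qk]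
    simp only [hQu] at hu
    rw [lintegral_eq_zero_iff (hGm n).ennreal_ofReal] at hu
    refine ae_eq_bot.1 (Filter.empty_mem_iff_bot.1 ?_)
    filter_upwards [hu] with x hx
    exact (ENNReal.ofReal_pos.2 (hG n x).1).ne' hx

/-- The backward kernel `Mback` associated to a probability measure is a Markov kernel. -/
lemma exists_kernel_Mback {q : ℕ} {γ : Measure (E q)} (hGm : Measurable (G q))
    (hHm : Measurable (Function.uncurry (H q))) [IsProbabilityMeasure γ]
    (h0 : ∀ y, ∫⁻ x, ENNReal.ofReal (G q x * H q x y) ∂γ ≠ 0)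
    (htop : ∀ y, ∫⁻ x, ENNReal.ofReal (G q x * H q x y) ∂γ ≠ ∞) :
    ∃ N : Kernel (E (q+1)) (E q), IsMarkovKernel N ∧ ∀ y, N y = Mback G H q γ y := by
  have hg : Measurable fun z : E (q+1) × E q => ENNReal.ofReal (G q z.2 * H q z.2 z.1) :=
    ((hGm.comp measurable_snd).mul (hHm.comp measurable_swap)).ennreal_ofReal
  have hgy : ∀ y, Measurable fun x => ENNReal.ofReal (G q x * H q x y) := fun y =>
    hg.comp (measurable_const.prodMk measurable_id)
  let d : E (q+1) → E q → ℝ≥0∞ := fun y x =>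
    (∫⁻ x, ENNReal.ofReal (G q x * H q x y) ∂γ)⁻¹ * ENNReal.ofReal (G q x * H q x y)
  have hd : Measurable (Function.uncurry d) :=
    (hg.lintegral_prod_right'.inv.comp measurable_fst).mul hg
  have hN : ∀ y, (Kernel.const (E (q+1)) γ).withDensity d y = Mback G H q γ y := fun y => by
    rw [Kernel.withDensity_apply _ hd, Kernel.const_apply, Mback, ← withDensity_smul _ (hgy y)]
    rfl
  refine ⟨(Kernel.const _ γ).withDensity d, ⟨fun y => ⟨?_⟩⟩, hN⟩
  rw [hN, Mback, Measure.smul_apply, withDensity_apply _ MeasurableSet.univ, Measure.restrict_univ,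
    smul_eq_mul, ENNReal.inv_mul_cancel (h0 y) (htop y)]

lemma boundedMeasurable_integral_snoc {n : ℕ} (hM : IsMarkovKernel (M n)) (hGm : Measurable (G n))
    (hG : ∀ x, G n x ∈ Set.Ioc (0:ℝ) 1) {F : (∀ i : Fin (n+1+1), E ↑i) → ℝ}
    (hF : BoundedMeasurable F) :
    BoundedMeasurable fun xs : ∀ i : Fin (n+1), E ↑i =>
      ∫ y, F (Fin.snoc xs y) ∂(Qk M G n (xs (Fin.last n))) := by
  obtain ⟨Q, hQfin, hQ⟩ := exists_kernel_Qk M G hM hGm hG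
  have hl : Measurable fun xs : ∀ i : Fin (n+1), E ↑i => xs (Fin.last n) := measurable_pi_apply _
  have h := (hF.comp (measurable_path_snoc (E := E) n)).integral_kernel (Q.comap _ hl)
  simp only [Kernel.comap_apply, hQ] at h
  exact h

lemma fwdAbs_self (p : ℕ) (F : (∀ i : Fin (p+1), E ↑i) → ℝ) : fwdAbs M G p p F = F := by
  cases p with
  | zero => rfl
  | succ p => simp only [fwdAbs, le_refl, dite_true]; rfl

lemma fwdAbs_succ {p n : ℕ} (h : p ≤ n) (F : (∀ i : Fin (n+1+1), E ↑i) → ℝ) :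
    fwdAbs M G p (n+1) F
      = fwdAbs M G p n fun xs => ∫ y, F (Fin.snoc xs y) ∂(Qk M G n (xs (Fin.last n))) := by
  rw [fwdAbs, dif_neg (by omega)]

lemma GammaInt_eq_GammaInt_fwdAbs (η0 : Measure (E 0)) (p k : ℕ)
    (F : (∀ i : Fin (p+k+1), E ↑i) → ℝ) :
    GammaInt M G η0 (p+k) F = GammaInt M G η0 p (fwdAbs M G p (p+k) F) := by
  induction k with
  | zero => exact congrArg _ (fwdAbs_self M G p F).symm
  | succ k ih =>
    exact (ih _).trans (congrArg _ (fwdAbs_succ M G (Nat.le_add_right p k) F).symm)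

lemma boundedMeasurable_fwdAbs (hM : ∀ q, IsMarkovKernel (M q)) (hGm : ∀ q, Measurable (G q))
    (hG : ∀ q x, G q x ∈ Set.Ioc (0:ℝ) 1) (p k : ℕ) {F : (∀ i : Fin (p+k+1), E ↑i) → ℝ}
    (hF : BoundedMeasurable F) : BoundedMeasurable (fwdAbs M G p (p+k) F) := by
  induction k with
  | zero => exact (fwdAbs_self M G p F).symm ▸ hF
  | succ k ih =>
    have h := ih (boundedMeasurable_integral_snoc M G (hM _) (hGm _) (hG _) hF)
    exact (fwdAbs_succ M G (Nat.le_add_right p k) F).symm ▸ h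

/-- The path measure `Γ_p` disintegrates as `γ_p` followed by the backward path kernel. -/
lemma exists_backward_path_kernel
    (lam : ∀ n, Measure (E n)) (η0 : Measure (E 0))
    (hM : ∀ q, IsMarkovKernel (M q))
    (hGm : ∀ q, Measurable (G q)) (hG : ∀ q x, G q x ∈ Set.Ioc (0:ℝ) 1)
    (hHm : ∀ q, Measurable (Function.uncurry (H q)))
    (hHpos : ∀ q x y, 0 < H q x y)
    (hlam : ∀ n, SigmaFinite (lam n))
    (hMH : ∀ q x, (M q x : Measure (E (q+1)))
      = (lam (q+1)).withDensity fun y => ENNReal.ofReal (H q x y))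
    (hHint : ∀ q (η : Measure (E q)), IsProbabilityMeasure η → ∀ y,
      ∫⁻ x, ENNReal.ofReal (G q x * H q x y) ∂η < ⊤)
    (hη0 : IsProbabilityMeasure η0) (p : ℕ) :
    ∃ B : Kernel (E p) (∀ i : Fin (p+1), E ↑i), IsMarkovKernel B ∧
      (∀ x F, BoundedMeasurable F →
        bwd0 G H (fun q => nz (gamma M G η0 q)) p x F = ∫ z, F z ∂(B x)) ∧
      (∀ x, ∀ φ : E p × (∀ i : Fin (p+1), E ↑i) → ℝ≥0∞, Measurable φ →
        ∫⁻ z, φ (z (Fin.last p), z) ∂(B x) = ∫⁻ z, φ (x, z) ∂(B x)) ∧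
      (∀ F, BoundedMeasurable F →
        GammaInt M G η0 p F = ∫ z, F z ∂((gamma M G η0 p).bind B)) := by
  induction p with
  | zero =>
    have hc : Measurable fun x : E 0 =>
        (Fin.cons x (fun j => j.elim0) : ∀ i : Fin (0+1), E ↑i) := by
      refine measurable_pi_iff.2 fun i => ?_
      obtain rfl : i = 0 := Fin.fin_one_eq_zero i
      exact measurable_id
    refine ⟨Kernel.deterministic _ hc, inferInstance, fun x F hF => ?_, fun x φ hφ => ?_,
      fun F hF => ?_⟩
    · rw [Kernel.deterministic_apply, integral_dirac' _ _ hF.1.stronglyMeasurable]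
      rfl
    · have h1 : Measurable fun z : ∀ i : Fin (0+1), E ↑i => φ (z (Fin.last 0), z) :=
        hφ.comp ((measurable_pi_apply _).prodMk measurable_id)
      have h2 : Measurable fun z : ∀ i : Fin (0+1), E ↑i => φ (x, z) :=
        hφ.comp (measurable_const.prodMk measurable_id)
      rw [Kernel.deterministic_apply, lintegral_dirac' _ h1, lintegral_dirac' _ h2]
      rfl
    · have : IsFiniteMeasure (gamma M G η0 0) := inferInstanceAs (IsFiniteMeasure η0)
      rw [hF.integral_bind]
      simp only [Kernel.deterministic_apply, integral_dirac' _ _ hF.1.stronglyMeasurable]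
      rfl
  | succ p ih =>
    obtain ⟨B, hBM, hB, hBl, hBΓ⟩ := ih
    obtain ⟨hγfin, hγ0⟩ := gamma_finite_ne_zero M G η0 hη0 hM hGm hG p
    obtain ⟨Q, hQfin, hQ⟩ := exists_kernel_Qk M G (hM p) (hGm p) (hG p)
    set γ := gamma M G η0 p with hγdef
    have hγu : γ Set.univ ≠ 0 := by simpa using hγ0
    have hprob : IsProbabilityMeasure (nz γ) :=
      ⟨by rw [nz, Measure.smul_apply, smul_eq_mul,
        ENNReal.inv_mul_cancel hγu (measure_ne_top _ _)]⟩
    have hg : Measurable (Function.uncurry fun x y => ENNReal.ofReal (G p x * H p x y)) :=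
      (((hGm p).comp measurable_fst).mul (hHm p)).ennreal_ofReal
    have hgy : ∀ y, Measurable fun x => ENNReal.ofReal (G p x * H p x y) :=
      fun y => hg.of_uncurry_right
    have hpos : ∀ (μ : Measure (E p)), μ ≠ 0 → ∀ y,
        ∫⁻ x, ENNReal.ofReal (G p x * H p x y) ∂μ ≠ 0 := fun μ hμ y h => by
      rw [lintegral_eq_zero_iff (hgy y)] at h
      refine hμ (ae_eq_bot.1 (Filter.empty_mem_iff_bot.1 ?_))
      filter_upwards [h] with x hx
      exact (ENNReal.ofReal_pos.2 (mul_pos (hG p x).1 (hHpos p x y))).ne' hx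
    have htop : ∀ y, ∫⁻ x, ENNReal.ofReal (G p x * H p x y) ∂γ ≠ ∞ := fun y h => by
      have := hHint p (nz γ) hprob y
      rw [nz, lintegral_smul_measure, h, smul_eq_mul,
        ENNReal.mul_top (ENNReal.inv_ne_zero.2 (measure_ne_top _ _))] at this
      exact this.ne rfl
    obtain ⟨N, hNM, hN⟩ := exists_kernel_Mback G H (γ := nz γ) (hGm p) (hHm p)
      (hpos _ (IsProbabilityMeasure.ne_zero _)) (fun y => (hHint p _ hprob y).ne)
    obtain ⟨B', hB'M, hB'⟩ := exists_kernel_map_section (B ∘ₖ N) (measurable_path_snoc (E := E) p)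
    have hsy : ∀ y : E (p+1), Measurable fun xs : ∀ i : Fin (p+1), E ↑i =>
        (Fin.snoc xs y : ∀ i : Fin (p+1+1), E ↑i) := fun y =>
      (measurable_path_snoc (E := E) p).comp (measurable_id.prodMk measurable_const)
    have hQlam : ∀ x, Q x
        = (lam (p+1)).withDensity fun y => ENNReal.ofReal (G p x * H p x y) := fun x => by
      have hHx : Measurable fun y => ENNReal.ofReal (H p x y) :=
        (hHm p).of_uncurry_left.ennreal_ofReal
      rw [hQ, Qk, hMH, ← withDensity_smul _ hHx]
      congr 1
      funext y
      simp [ENNReal.ofReal_mul (hG p x).1.le]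
    have hl : Measurable fun xs : ∀ i : Fin (p+1), E ↑i => xs (Fin.last p) :=
      measurable_pi_apply _
    have hlam' := hlam (p+1)
    refine ⟨B', hB'M, fun x F hF => ?_, fun x φ hφ => ?_, fun F hF => ?_⟩
    · have hFx := hF.comp (hsy x)
      rw [hB', integral_map (hsy x).aemeasurable hF.1.aestronglyMeasurable, Kernel.comp_apply,
        hFx.integral_bind, hN]
      exact integral_congr_ae (ae_of_all _ fun y => hB y _ hFx)
    · have h1 : Measurable fun z : ∀ i : Fin (p+1+1), E ↑i => φ (z (Fin.last (p+1)), z) :=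
        hφ.comp ((measurable_pi_apply _).prodMk measurable_id)
      have h2 : Measurable fun z : ∀ i : Fin (p+1+1), E ↑i => φ (x, z) :=
        hφ.comp (measurable_const.prodMk measurable_id)
      rw [hB', lintegral_map h1 (hsy x), lintegral_map h2 (hsy x)]
      simp only [Fin.snoc_last]
    · have hstep := map_compProd_eq_bind_backward hγ0 hg (hpos γ hγ0) htop hQlam hN hl hBl
        (measurable_path_snoc (E := E) p) hB'
      have hγs : gamma M G η0 (p+1) = γ.bind Q := by
        rw [gamma, show Qk M G p = Q from funext fun x => (hQ x).symm]
      rw [hγs, ← hstep, integral_map (measurable_path_snoc (E := E) p).aemeasurable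
        hF.1.aestronglyMeasurable, Measure.integral_compProd
        ((hF.comp (measurable_path_snoc (E := E) p)).integrable _)]
      simp only [Kernel.comap_apply, hQ]
      exact hBΓ _ (boundedMeasurable_integral_snoc M G (hM p) (hGm p) (hG p) hF)

end PathSpaceSemigroup

/-- path-space semigroup formula. For any `0 ≤ p ≤ n` (here `n = p + k`)
and any bounded measurable `F_n` on `E_0 × ⋯ × E_n`:
`Γ_n(F_n) = γ_p(D_{p,n}(F_n))` and `ℚ_n(F_n) = η_p(D_{p,n}(F_n)) / η_p(D_{p,n}(1))`. -/
theorem path_space_semigroup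
    (lam : ∀ n, Measure (E n)) (η0 : Measure (E 0))
    (hM : ∀ q, IsMarkovKernel (M q))
    (hGm : ∀ q, Measurable (G q)) (hG : ∀ q x, G q x ∈ Set.Ioc (0:ℝ) 1)
    (hHm : ∀ q, Measurable (Function.uncurry (H q)))
    (hHpos : ∀ q x y, 0 < H q x y)
    (hlam : ∀ n, SigmaFinite (lam n))
    (hMH : ∀ q x, (M q x : Measure (E (q+1)))
      = (lam (q+1)).withDensity fun y => ENNReal.ofReal (H q x y))
    (hHint : ∀ q (η : Measure (E q)), IsProbabilityMeasure η → ∀ y,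
      ∫⁻ x, ENNReal.ofReal (G q x * H q x y) ∂η < ⊤)
    (hη0 : IsProbabilityMeasure η0)
    (p k : ℕ)
    (F : (∀ i : Fin (p+k+1), E ↑i) → ℝ) (hFm : Measurable F) (hFb : ∃ C, ∀ x, |F x| ≤ C) :
    (GammaInt M G η0 (p+k) F
        = ∫ x, Dop M G H (fun q => nz (gamma M G η0 q)) p (p+k) F x ∂ (gamma M G η0 p))
    ∧ GammaInt M G η0 (p+k) F / GammaInt M G η0 (p+k) (fun _ => (1:ℝ))
        = (∫ x, Dop M G H (fun q => nz (gamma M G η0 q)) p (p+k) F x ∂ (nz (gamma M G η0 p)))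
          / (∫ x, Dop M G H (fun q => nz (gamma M G η0 q)) p (p+k) (fun _ => (1:ℝ)) x
              ∂ (nz (gamma M G η0 p))) := by
  obtain ⟨hγfin, hγ0⟩ := gamma_finite_ne_zero M G η0 hη0 hM hGm hG p
  have key : ∀ F : (∀ i : Fin (p+k+1), E ↑i) → ℝ, BoundedMeasurable F →
      GammaInt M G η0 (p+k) F
        = ∫ x, Dop M G H (fun q => nz (gamma M G η0 q)) p (p+k) F x ∂(gamma M G η0 p) := by
    intro F hF
    obtain ⟨B, hBM, hB, -, hBΓ⟩ := exists_backward_path_kernel M G H lam η0 hM hGm hG hHm hHpos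
      hlam hMH hHint hη0 p
    have hfwd := boundedMeasurable_fwdAbs M G hM hGm hG p k hF
    rw [GammaInt_eq_GammaInt_fwdAbs, hBΓ _ hfwd, hfwd.integral_bind]
    exact integral_congr_ae (ae_of_all _ fun x => (hB x _ hfwd).symm)
  refine ⟨key F ⟨hFm, hFb⟩, ?_⟩
  have hc : ((gamma M G η0 p Set.univ)⁻¹).toReal ≠ 0 :=
    ENNReal.toReal_ne_zero.2 ⟨ENNReal.inv_ne_zero.2 (measure_ne_top _ _),
      ENNReal.inv_ne_top.2 (by simpa using hγ0)⟩
  rw [key F ⟨hFm, hFb⟩, key (fun _ => 1) ⟨measurable_const, 1, fun _ => by simp⟩]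
  simp only [nz, integral_smul_measure, smul_eq_mul]
  rw [mul_div_mul_left _ _ hc]

end
end

section
/- Weighted oscillation bound: let S be a Markov kernel from a measurable space E into a measurable space F, let g : F → (0,∞) be a bounded measurable function such that g(y) ≤ b · g(y') for all y, y' ∈ F (with b ≥ 1 finite), and let f : F → ℝ be bounded measurable. Then osc( S(gf)/S(g) ) ≤ b² · β(S) · osc(f). -/
open MeasureTheory ProbabilityTheory

noncomputable section

/-- The Dobrushin contraction coefficient
`β(S) = sup { osc(S(φ)) : φ bounded measurable, osc(φ) ≤ 1 }` of a Markov kernel. -/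
def betaKer {α β : Type*} [MeasurableSpace α] [MeasurableSpace β] (S : Kernel α β) : ℝ :=
  sSup {r | ∃ φ : β → ℝ, Measurable φ ∧ (∀ x y, |φ x - φ y| ≤ 1)
    ∧ r = osc fun x => ∫ y, φ y ∂ (S x)}

theorem le_integral_of_forall_le {β : Type*} [MeasurableSpace β] (μ : Measure β)
    [IsProbabilityMeasure μ] {φ : β → ℝ} (hφ : Integrable φ μ) {a : ℝ} (h : ∀ y, a ≤ φ y) :
    a ≤ ∫ y, φ y ∂μ := by
  simpa using integral_mono (integrable_const a) hφ h

theorem integral_le_of_forall_le {β : Type*} [MeasurableSpace β] (μ : Measure β)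
    [IsProbabilityMeasure μ] {φ : β → ℝ} (hφ : Integrable φ μ) {a : ℝ} (h : ∀ y, φ y ≤ a) :
    ∫ y, φ y ∂μ ≤ a := by
  simpa using integral_mono hφ (integrable_const a) h

theorem integrable_of_abs_le {β : Type*} [MeasurableSpace β] (μ : Measure β)
    [IsProbabilityMeasure μ] {φ : β → ℝ} (hm : Measurable φ) {C : ℝ} (h : ∀ y, |φ y| ≤ C) :
    Integrable φ μ :=
  Integrable.of_bound hm.aestronglyMeasurable C (ae_of_all _ h)

theorem integrable_of_abs_sub_le {β : Type*} [MeasurableSpace β] (μ : Measure β)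
    [IsProbabilityMeasure μ] {φ : β → ℝ} (hm : Measurable φ) {K : ℝ}
    (h : ∀ x y, |φ x - φ y| ≤ K) : Integrable φ μ := by
  obtain ⟨z⟩ := nonempty_of_isProbabilityMeasure μ
  refine integrable_of_abs_le μ hm (C := K + |φ z|) fun y => ?_
  linarith [h y z, abs_sub_abs_le_abs_sub (φ y) (φ z)]

theorem abs_integral_sub_integral_le {β : Type*} [MeasurableSpace β] (μ ν : Measure β)
    [IsProbabilityMeasure μ] [IsProbabilityMeasure ν] {φ : β → ℝ} (hm : Measurable φ) {K : ℝ}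
    (h : ∀ x y, |φ x - φ y| ≤ K) : |∫ y, φ y ∂μ - ∫ y, φ y ∂ν| ≤ K := by
  have key : ∀ (μ ν : Measure β) [IsProbabilityMeasure μ] [IsProbabilityMeasure ν],
      ∫ y, φ y ∂μ - ∫ y, φ y ∂ν ≤ K := by
    intro μ ν _ _
    have hx : ∀ x, φ x ≤ ∫ y, φ y ∂ν + K := fun x => by
      have := le_integral_of_forall_le ν (integrable_of_abs_sub_le ν hm h) (a := φ x - K)
        fun y => by linarith [(abs_le.1 (h x y)).2]
      linarith
    linarith [integral_le_of_forall_le μ (integrable_of_abs_sub_le μ hm h) hx]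
  exact abs_sub_le_iff.2 ⟨key μ ν, key ν μ⟩

theorem osc_nonneg {α : Type*} (f : α → ℝ) : 0 ≤ osc f := by
  apply Real.sSup_nonneg
  rintro _ ⟨x, y, rfl⟩
  exact abs_nonneg _

theorem osc_le {α : Type*} {f : α → ℝ} {K : ℝ} (hK : 0 ≤ K) (h : ∀ x y, |f x - f y| ≤ K) :
    osc f ≤ K := by
  apply Real.sSup_le _ hK
  rintro _ ⟨x, y, rfl⟩
  exact h x y

theorem abs_sub_le_osc {α : Type*} {f : α → ℝ} {K : ℝ} (h : ∀ x y, |f x - f y| ≤ K) (x y : α) :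
    |f x - f y| ≤ osc f := by
  refine le_csSup ⟨K, ?_⟩ ⟨x, y, rfl⟩
  rintro _ ⟨x, y, rfl⟩
  exact h x y

theorem betaKer_nonneg {α β : Type*} [MeasurableSpace α] [MeasurableSpace β] (S : Kernel α β) :
    0 ≤ betaKer S := by
  apply Real.sSup_nonneg
  rintro _ ⟨φ, -, -, rfl⟩
  exact osc_nonneg _

theorem abs_integral_sub_integral_le_betaKer {α β : Type*} [MeasurableSpace α]
    [MeasurableSpace β] (S : Kernel α β) [IsMarkovKernel S] {φ : β → ℝ} (hm : Measurable φ)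
    {K : ℝ} (hK : 0 ≤ K) (h : ∀ x y, |φ x - φ y| ≤ K) (x x' : α) :
    |∫ y, φ y ∂(S x) - ∫ y, φ y ∂(S x')| ≤ K * betaKer S := by
  rcases hK.eq_or_lt with rfl | hK
  · simpa using abs_integral_sub_integral_le (S x) (S x') hm h
  have hs : ∀ y y', |φ y / K - φ y' / K| ≤ 1 := fun y y' => by
    rw [← sub_div, abs_div, abs_of_pos hK, div_le_one hK]
    exact h y y'
  have hosc := abs_sub_le_osc (f := fun x => ∫ y, φ y / K ∂(S x)) (fun x x' =>
    abs_integral_sub_integral_le (S x) (S x') (hm.div_const K) hs) x x'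
  have hβ : osc (fun x => ∫ y, φ y / K ∂(S x)) ≤ betaKer S := by
    refine le_csSup ⟨1, ?_⟩ ⟨fun y => φ y / K, hm.div_const K, hs, rfl⟩
    rintro _ ⟨ψ, hψ, hψ1, rfl⟩
    exact osc_le zero_le_one fun x x' => abs_integral_sub_integral_le (S x) (S x') hψ hψ1
  have := hosc.trans hβ
  simp only [integral_div] at this
  rw [← sub_div, abs_div, abs_of_pos hK, div_le_iff₀ hK] at this
  linarith

/-- If the values of `f` oscillate by at most `D`, stay within `D` of `c`, and `0 ≤ g ≤ G`, then
`g * (f - c)` oscillates by at most `G * D`. -/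
theorem abs_weighted_sub_le {β : Type*} {f g : β → ℝ} {c D G : ℝ} (hg0 : ∀ y, 0 ≤ g y)
    (hgG : ∀ y, g y ≤ G) (hf : ∀ y y', |f y - f y'| ≤ D) (hc : ∀ y, |f y - c| ≤ D) (y y' : β) :
    |g y * (f y - c) - g y' * (f y' - c)| ≤ G * D := by
  have key : ∀ y y', g y * (f y - c) - g y' * (f y' - c) ≤ G * D := by
    intro y y'
    have hG : 0 ≤ G := (hg0 y).trans (hgG y)
    have h1 := mul_le_mul_of_nonneg_left (abs_le.1 (hf y y')).2 hG
    have h2 := mul_le_mul_of_nonneg_left (abs_le.1 (hc y)).2 hG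
    have h3 := mul_le_mul_of_nonneg_left (abs_le.1 (hc y')).1 hG
    have hD : 0 ≤ G * D := mul_nonneg hG ((abs_nonneg _).trans (hc y))
    rcases le_total 0 (f y - c) with h | h <;> rcases le_total 0 (f y' - c) with h' | h'
    · linarith [mul_le_mul_of_nonneg_right (hgG y) h, mul_nonneg (hg0 y') h']
    · linarith [mul_le_mul_of_nonneg_right (hgG y) h, mul_le_mul_of_nonpos_right (hgG y') h']
    · linarith [mul_nonpos_of_nonneg_of_nonpos (hg0 y) h, mul_nonneg (hg0 y') h']
    · linarith [mul_nonpos_of_nonneg_of_nonpos (hg0 y) h,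
        mul_le_mul_of_nonpos_right (hgG y') h']
  exact abs_sub_le_iff.2 ⟨key y y', key y' y⟩

/-- weighted oscillation bound. If `S` is a Markov kernel from `E` to `F`,
`g : F → (0,∞)` is bounded measurable with `g(y) ≤ b g(y')` for all `y, y'` (`b ≥ 1` finite),
and `f` is bounded measurable, then `osc(S(gf)/S(g)) ≤ b² β(S) osc(f)`. -/
theorem weighted_oscillation_bound
    {α β : Type*} [MeasurableSpace α] [MeasurableSpace β]
    (S : Kernel α β) (hS : IsMarkovKernel S)
    (g : β → ℝ) (hgm : Measurable g) (hgpos : ∀ y, 0 < g y) (hgb : ∃ C, ∀ y, |g y| ≤ C)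
    (b : ℝ) (hb : 1 ≤ b) (hg : ∀ y y', g y ≤ b * g y')
    (f : β → ℝ) (hfm : Measurable f) (hfb : ∃ C, ∀ y, |f y| ≤ C) :
    osc (fun x => (∫ y, g y * f y ∂ (S x)) / ∫ y, g y ∂ (S x))
      ≤ b^2 * betaKer S * osc f := by
  obtain ⟨Cg, hCg⟩ := hgb
  obtain ⟨Cf, hCf⟩ := hfb
  have hD : ∀ y y', |f y - f y'| ≤ osc f := by
    refine abs_sub_le_osc (K := Cf + Cf) fun y y' => ?_
    linarith [abs_sub (f y) (f y'), hCf y, hCf y']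
  have hD0 := osc_nonneg f
  have hβ0 := betaKer_nonneg S
  have hgi : ∀ x, Integrable g (S x) := fun x => integrable_of_abs_le _ hgm hCg
  have hgfi : ∀ x, Integrable (fun y => g y * f y) (S x) := fun x =>
    integrable_of_abs_le _ (hgm.mul hfm) (C := Cg * Cf) fun y => by
      rw [abs_mul]
      exact mul_le_mul (hCg y) (hCf y) (abs_nonneg _) ((abs_nonneg _).trans (hCg y))
  have hgG : ∀ x y, g y ≤ b * ∫ z, g z ∂(S x) := fun x y => by
    rw [← integral_const_mul]
    exact le_integral_of_forall_le _ ((hgi x).const_mul b) fun z => hg y z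
  have hIpos : ∀ x, 0 < ∫ z, g z ∂(S x) := fun x => by
    obtain ⟨y⟩ := nonempty_of_isProbabilityMeasure (S x)
    exact pos_of_mul_pos_right ((hgpos y).trans_le (hgG x y)) (zero_le_one.trans hb)
  have hshift : ∀ (c : ℝ) (x : α), ∫ y, g y * (f y - c) ∂(S x)
      = ∫ y, g y * f y ∂(S x) - (∫ y, g y ∂(S x)) * c := fun c x => by
    simp only [mul_sub]
    rw [integral_sub (hgfi x) ((hgi x).mul_const c), integral_mul_const]
  refine osc_le (by positivity) fun x x' => ?_
  set c := (∫ y, g y * f y ∂(S x')) / ∫ y, g y ∂(S x') with hc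
  have hcD : ∀ y, |f y - c| ≤ osc f := fun y => by
    have h1 : (∫ z, g z ∂(S x')) * (f y - osc f) ≤ ∫ z, g z * f z ∂(S x') := by
      rw [← integral_mul_const]
      refine integral_mono ((hgi x').mul_const _) (hgfi x') fun z => ?_
      exact mul_le_mul_of_nonneg_left (by linarith [(abs_le.1 (hD y z)).2]) (hgpos z).le
    have h2 : ∫ z, g z * f z ∂(S x') ≤ (∫ z, g z ∂(S x')) * (f y + osc f) := by
      rw [← integral_mul_const]
      refine integral_mono (hgfi x') ((hgi x').mul_const _) fun z => ?_
      exact mul_le_mul_of_nonneg_left (by linarith [(abs_le.1 (hD y z)).1]) (hgpos z).le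
    have h1' : f y - osc f ≤ c := by
      rw [hc, le_div_iff₀ (hIpos x')]
      linarith
    have h2' : c ≤ f y + osc f := by
      rw [hc, div_le_iff₀ (hIpos x')]
      linarith
    exact abs_le.2 ⟨by linarith, by linarith⟩
  have hIx := hIpos x
  have hmain := abs_integral_sub_integral_le_betaKer S (hgm.mul (hfm.sub_const c))
    (K := (b * ∫ z, g z ∂(S x)) * osc f) (by positivity)
    (abs_weighted_sub_le (fun y => (hgpos y).le) (hgG x) hD hcD) x x'
  have hzero : ∫ y, g y * (f y - c) ∂(S x') = 0 := by
    rw [hshift, hc, mul_div_cancel₀ _ (hIpos x').ne', sub_self]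
  simp only [Pi.mul_apply] at hmain
  rw [hzero, sub_zero, hshift] at hmain
  have hdiv : (∫ y, g y * f y ∂(S x)) / (∫ y, g y ∂(S x)) - c
      = (∫ y, g y * f y ∂(S x) - (∫ y, g y ∂(S x)) * c) / ∫ y, g y ∂(S x) := by
    field_simp
  rw [hdiv, abs_div, abs_of_pos hIx, div_le_iff₀ hIx]
  refine hmain.trans ?_
  have hb2 : b ≤ b ^ 2 := by nlinarith
  have h := mul_le_mul_of_nonneg_right hb2
    (by positivity : 0 ≤ betaKer S * osc f * ∫ z, g z ∂(S x))
  linarith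

end
end
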